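/- Suppose f ∈ E_{7/6,7/6} and φ ∈ L¹(√ω dω) solve −𝒞(f)(ω) = φ(ω) for all ω > 0 (in the local sense), with asymptotics f(ω) = c₀ ω^{-7/6} + o(ω^{-7/6}) as ω → 0 and f(ω) = c_∞ ω^{-7/6} + o(ω^{-7/6}) as ω → ∞. Then the mass balance c₀³ = c_∞³ + M(φ)/j_M* holds, where M(φ) = ∫₀^∞ √ω φ(ω) dω and j_M* = −J_M(ω^{-7/6})(1) > 0, and moreover J_M(f)(ω) = −c₀³ j_M* + ∫₀^ω √σ φ(σ) dσ for all ω > 0. -/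

import Mathlib

open MeasureTheory Set Filter

/-- The interaction weight W = min(√ω₁,√ω₂,√ω₃,√ω₄)/√ω₁. -/
noncomputable def W (a b c d : ℝ) : ℝ :=
  min (min (Real.sqrt a) (Real.sqrt b)) (min (Real.sqrt c) (Real.sqrt d)) / Real.sqrt a

/-- Generic flux integral: integrand √ω₁ W f₁ f₂ f₃ over a region S of (ω₁,ω₂,ω₃),
with ω₄ = ω₁+ω₂−ω₃. -/
noncomputable def Jint (f : ℝ → ℝ) (S : Set (ℝ × ℝ × ℝ)) : ℝ :=
  ∫ q in S, Real.sqrt q.1 * W q.1 q.2.1 q.2.2 (q.1 + q.2.1 - q.2.2) *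
    f q.1 * f q.2.1 * f q.2.2

/-- Region of J₁(f)(ω). -/
def S1 (ω : ℝ) : Set (ℝ × ℝ × ℝ) :=
  {q | 0 < q.1 ∧ 0 < q.2.1 ∧ q.2.1 < ω ∧ ω < q.2.2 ∧ q.2.2 < q.1 + q.2.1}

/-- Region of J₂(f)(ω). -/
def S2 (ω : ℝ) : Set (ℝ × ℝ × ℝ) :=
  {q | 0 < q.1 ∧ q.1 < ω ∧ ω - q.1 < q.2.1 ∧ 0 < q.2.2 ∧ q.2.2 < q.1 + q.2.1 - ω}

/-- Region of J₃(f)(ω). -/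
def S3 (ω : ℝ) : Set (ℝ × ℝ × ℝ) :=
  {q | 0 < q.1 ∧ ω < q.2.1 ∧ 0 < q.2.2 ∧ q.2.2 < ω}

/-- Region of J₄(f)(ω). -/
def S4 (ω : ℝ) : Set (ℝ × ℝ × ℝ) :=
  {q | ω < q.1 ∧ 0 < q.2.1 ∧ q.1 + q.2.1 - ω < q.2.2 ∧ q.2.2 < q.1 + q.2.1}

/-- The mass flux J_M = J₁ + J₂ − J₃ − J₄. -/
noncomputable def JM (f : ℝ → ℝ) (ω : ℝ) : ℝ :=
  Jint f (S1 ω) + Jint f (S2 ω) - Jint f (S3 ω) - Jint f (S4 ω)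

/-- The energy flux J_E(f)(ω) = ω J_M(f)(ω) − ∫₀^ω J_M(f)(σ) dσ. -/
noncomputable def JE (f : ℝ → ℝ) (ω : ℝ) : ℝ :=
  ω * JM f ω - ∫ σ in Set.Ioo (0:ℝ) ω, JM f σ

/-- The integrand of the isotropic 4-wave collision operator, in the variables
(ω₃,ω₄) = p, with ω₂ = ω₃ + ω₄ - ω₁. -/
noncomputable def collisionIntegrand (f : ℝ → ℝ) (ω₁ : ℝ) (p : ℝ × ℝ) : ℝ :=
  W ω₁ (p.1 + p.2 - ω₁) p.1 p.2 *
    ((f ω₁ + f (p.1 + p.2 - ω₁)) * f p.1 * f p.2 -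
      (f p.1 + f p.2) * f ω₁ * f (p.1 + p.2 - ω₁))

/-- The integration domain {ω₂, ω₃, ω₄ ≥ 0}. -/
def collisionDomain (ω₁ : ℝ) : Set (ℝ × ℝ) :=
  {p | 0 ≤ p.1 ∧ 0 ≤ p.2 ∧ 0 ≤ p.1 + p.2 - ω₁}

/-- The isotropic 4-wave collision operator. -/
noncomputable def collisionOp (f : ℝ → ℝ) (ω₁ : ℝ) : ℝ :=
  ∫ p in collisionDomain ω₁, collisionIntegrand f ω₁ p

/-! ### Measure-preserving linear substitutions -/

/-- A linear involution of a finite-dimensional space preserves every additive Haar measure. -/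
lemma measurePreserving_of_linear_involution {E : Type*} [NormedAddCommGroup E] [NormedSpace ℝ E]
    [MeasurableSpace E] [BorelSpace E] [FiniteDimensional ℝ E] (μ : Measure E)
    [μ.IsAddHaarMeasure] (L : E →ₗ[ℝ] E) (hL : L ∘ₗ L = LinearMap.id) :
    MeasurePreserving L μ μ := by
  have hdet : LinearMap.det L * LinearMap.det L = 1 := by
    rw [← LinearMap.det_comp, hL, LinearMap.det_id]
  have habs : |(LinearMap.det L)⁻¹| = 1 := by
    rcases mul_self_eq_one_iff.1 hdet with h | h <;> simp [h]
  refine ⟨L.continuous_of_finiteDimensional.measurable, ?_⟩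
  rw [Measure.map_linearMap_addHaar_eq_smul_addHaar μ (left_ne_zero_of_mul_eq_one hdet), habs]
  simp

instance isAddHaarMeasure_volume_prod₂ : (volume : Measure (ℝ × ℝ)).IsAddHaarMeasure :=
  Measure.prod.instIsAddHaarMeasure _ _

instance isAddHaarMeasure_volume_prod₃ : (volume : Measure (ℝ × ℝ × ℝ)).IsAddHaarMeasure :=
  Measure.prod.instIsAddHaarMeasure _ _

lemma measurePreserving_swap₁₂ :
    MeasurePreserving (fun q : ℝ × ℝ × ℝ => (q.2.1, q.1, q.2.2)) := by
  refine measurePreserving_of_linear_involution volume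
    { toFun := fun q : ℝ × ℝ × ℝ => (q.2.1, q.1, q.2.2)
      map_add' := ?_, map_smul' := ?_ } ?_
  · intros; rfl
  · intros; rfl
  · ext <;> simp

lemma measurePreserving_swap₂₃ :
    MeasurePreserving (fun q : ℝ × ℝ × ℝ => (q.1, q.2.2, q.2.1)) := by
  refine measurePreserving_of_linear_involution volume
    { toFun := fun q : ℝ × ℝ × ℝ => (q.1, q.2.2, q.2.1)
      map_add' := ?_, map_smul' := ?_ } ?_
  · intros; rfl
  · intros; rfl
  · ext <;> simp

lemma measurePreserving_swap₃₄ :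
    MeasurePreserving (fun q : ℝ × ℝ × ℝ => (q.1, q.2.1, q.1 + q.2.1 - q.2.2)) := by
  refine measurePreserving_of_linear_involution volume
    { toFun := fun q : ℝ × ℝ × ℝ => (q.1, q.2.1, q.1 + q.2.1 - q.2.2)
      map_add' := ?_, map_smul' := ?_ } ?_
  · intro p q; ext <;> simp; ring
  · intro c q; ext <;> simp; ring
  · ext <;> simp

lemma measurePreserving_swap_pairs :
    MeasurePreserving (fun q : ℝ × ℝ × ℝ => (q.1 + q.2.1 - q.2.2, q.2.2, q.2.1)) := by
  refine measurePreserving_of_linear_involution volume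
    { toFun := fun q : ℝ × ℝ × ℝ => (q.1 + q.2.1 - q.2.2, q.2.2, q.2.1)
      map_add' := ?_, map_smul' := ?_ } ?_
  · intro p q; ext <;> simp; ring
  · intro c q; ext <;> simp; ring
  · ext <;> simp

lemma measurePreserving_total :
    MeasurePreserving (fun q : ℝ × ℝ × ℝ => (q.2.1, q.1 - q.2.1, q.2.2)) := by
  have h₁ : MeasurePreserving (fun q : ℝ × ℝ × ℝ => (q.1, q.1 - q.2.1, q.2.2)) := by
    refine measurePreserving_of_linear_involution volume
      { toFun := fun q : ℝ × ℝ × ℝ => (q.1, q.1 - q.2.1, q.2.2)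
        map_add' := ?_, map_smul' := ?_ } ?_
    · intro p q; ext <;> simp; ring
    · intro c q; ext <;> simp; ring
    · ext <;> simp
  have h₂ : MeasurePreserving (fun q : ℝ × ℝ × ℝ => (q.1, -q.2.1, q.2.2)) := by
    refine measurePreserving_of_linear_involution volume
      { toFun := fun q : ℝ × ℝ × ℝ => (q.1, -q.2.1, q.2.2)
        map_add' := ?_, map_smul' := ?_ } ?_
    · intro p q; ext <;> simp; ring
    · intro c q; ext <;> simp
    · ext <;> simp
  convert h₂.comp (h₁.comp measurePreserving_swap₁₂) using 2 with q
  simp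

/-! ### The cubic density of the flux integrals -/

/-- The interacting frequencies `ω₁, ω₂, ω₃` and `ω₄ = ω₁ + ω₂ - ω₃`. -/
def freq : Fin 4 → ℝ × ℝ × ℝ → ℝ :=
  ![fun q => q.1, fun q => q.2.1, fun q => q.2.2, fun q => q.1 + q.2.1 - q.2.2]

@[simp] lemma freq_zero (q : ℝ × ℝ × ℝ) : freq 0 q = q.1 := rfl
@[simp] lemma freq_one (q : ℝ × ℝ × ℝ) : freq 1 q = q.2.1 := rfl
@[simp] lemma freq_two (q : ℝ × ℝ × ℝ) : freq 2 q = q.2.2 := rfl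
@[simp] lemma freq_three (q : ℝ × ℝ × ℝ) : freq 3 q = q.1 + q.2.1 - q.2.2 := rfl

@[fun_prop]
lemma measurable_freq (i : Fin 4) : Measurable (freq i) := by
  fin_cases i <;> simp [freq] <;> fun_prop

lemma freq_smul (i : Fin 4) (s : ℝ) (q : ℝ × ℝ × ℝ) : freq i (s • q) = s * freq i q := by
  fin_cases i <;> simp [freq]; ring

/-- The symmetric weight `min(√ω₁, √ω₂, √ω₃, √ω₄)`. -/
noncomputable def minSqrt (a b c d : ℝ) : ℝ := min (min √a √b) (min √c √d)

/-- The density `min(√ω₁, √ω₂, √ω₃, √ω₄) f(ω₁) f(ω₂) f(ω₃)`. -/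
noncomputable def fluxDensity (f : ℝ → ℝ) (q : ℝ × ℝ × ℝ) : ℝ :=
  minSqrt q.1 q.2.1 q.2.2 (q.1 + q.2.1 - q.2.2) * f q.1 * f q.2.1 * f q.2.2

lemma sqrt_mul_W (a b c d : ℝ) : √a * W a b c d = minSqrt a b c d := by
  unfold W minSqrt
  rcases le_or_gt a 0 with ha | ha
  · simp [Real.sqrt_eq_zero_of_nonpos ha, Real.sqrt_nonneg]
  · have := (Real.sqrt_pos.2 ha).ne'
    field_simp

lemma minSqrt_nonneg (a b c d : ℝ) : 0 ≤ minSqrt a b c d := by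
  simp [minSqrt, Real.sqrt_nonneg]

lemma minSqrt_pos {a b c d : ℝ} :
    0 < minSqrt a b c d ↔ 0 < a ∧ 0 < b ∧ 0 < c ∧ 0 < d := by
  simp [minSqrt, and_assoc]

lemma minSqrt_mul {s : ℝ} (hs : 0 ≤ s) (a b c d : ℝ) :
    minSqrt (s * a) (s * b) (s * c) (s * d) = √s * minSqrt a b c d := by
  simp only [minSqrt, Real.sqrt_mul hs, mul_min_of_nonneg _ _ (Real.sqrt_nonneg s)]

@[fun_prop]
lemma Measurable.minSqrt {α : Type*} [MeasurableSpace α] {a b c d : α → ℝ} (ha : Measurable a)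
    (hb : Measurable b) (hc : Measurable c) (hd : Measurable d) :
    Measurable (fun x => minSqrt (a x) (b x) (c x) (d x)) := by
  unfold _root_.minSqrt
  fun_prop

@[fun_prop]
lemma measurable_fluxDensity {f : ℝ → ℝ} (hf : Measurable f) : Measurable (fluxDensity f) := by
  unfold fluxDensity
  fun_prop

lemma freq_pos_of_minSqrt_ne_zero {q : ℝ × ℝ × ℝ}
    (h : minSqrt q.1 q.2.1 q.2.2 (q.1 + q.2.1 - q.2.2) ≠ 0) (i : Fin 4) : 0 < freq i q := by
  obtain ⟨h₁, h₂, h₃, h₄⟩ := minSqrt_pos.1 ((minSqrt_nonneg _ _ _ _).lt_of_ne' h)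
  fin_cases i
  exacts [h₁, h₂, h₃, h₄]

lemma freq_pos_of_fluxDensity_ne_zero {f : ℝ → ℝ} {q : ℝ × ℝ × ℝ} (h : fluxDensity f q ≠ 0)
    (i : Fin 4) : 0 < freq i q := by
  refine freq_pos_of_minSqrt_ne_zero ?_ i
  intro h0
  simp [fluxDensity, h0] at h

/-- The set of quadruples whose `i`-th frequency is below `ω` and whose `j`-th is above. -/
def crossing (i j : Fin 4) (ω : ℝ) : Set (ℝ × ℝ × ℝ) := {q | freq i q < ω ∧ ω < freq j q}

lemma measurableSet_crossing (i j : Fin 4) (ω : ℝ) : MeasurableSet (crossing i j ω) :=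
  (measurableSet_lt (measurable_freq i) measurable_const).inter
    (measurableSet_lt measurable_const (measurable_freq j))

lemma Jint_eq_setIntegral_crossing (f : ℝ → ℝ) {S : Set (ℝ × ℝ × ℝ)} (hS : MeasurableSet S)
    (i j : Fin 4) (ω : ℝ)
    (h : ∀ q, (∀ k, 0 < freq k q) → (q ∈ S ↔ q ∈ crossing i j ω)) :
    Jint f S = ∫ q in crossing i j ω, fluxDensity f q := by
  have hdens : Jint f S = ∫ q in S, fluxDensity f q := by
    simp only [Jint, sqrt_mul_W, fluxDensity]
  rw [hdens, ← integral_indicator hS, ← integral_indicator (measurableSet_crossing i j ω)]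
  congr 1 with q
  by_cases h0 : fluxDensity f q = 0
  · rw [indicator_apply_eq_zero.2 fun _ => h0, indicator_apply_eq_zero.2 fun _ => h0]
  · have := h q (freq_pos_of_fluxDensity_ne_zero h0)
    by_cases hqS : q ∈ S
    · rw [indicator_of_mem hqS, indicator_of_mem (this.1 hqS)]
    · rw [indicator_of_notMem hqS, indicator_of_notMem (mt this.2 hqS)]

lemma JM_eq_crossing (f : ℝ → ℝ) (ω : ℝ) :
    JM f ω = (∫ q in crossing 1 2 ω, fluxDensity f q) + (∫ q in crossing 0 3 ω, fluxDensity f q)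
      - (∫ q in crossing 2 1 ω, fluxDensity f q) - ∫ q in crossing 3 0 ω, fluxDensity f q := by
  unfold JM
  congr 1
  · congr 1
    · congr 1
      · refine Jint_eq_setIntegral_crossing f ?_ 1 2 ω fun q hq => ?_
        · unfold S1; measurability
        · have h0 := hq 0; have h1 := hq 1; have h2 := hq 2; have h3 := hq 3
          simp only [freq_zero, freq_one, freq_two, freq_three] at *
          simp only [S1, crossing, mem_ofPred_eq, freq_one, freq_two]
          constructor
          · rintro ⟨_, _, _, _, _⟩; constructor <;> assumption
          · rintro ⟨_, _⟩; refine ⟨?_, ?_, ?_, ?_, ?_⟩ <;> linarith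
      · refine Jint_eq_setIntegral_crossing f ?_ 0 3 ω fun q hq => ?_
        · unfold S2; measurability
        · have h0 := hq 0; have h1 := hq 1; have h2 := hq 2; have h3 := hq 3
          simp only [freq_zero, freq_one, freq_two, freq_three] at *
          simp only [S2, crossing, mem_ofPred_eq, freq_zero, freq_three]
          constructor
          · rintro ⟨_, _, _, _, _⟩; constructor <;> linarith
          · rintro ⟨_, _⟩; refine ⟨?_, ?_, ?_, ?_, ?_⟩ <;> linarith
    · refine Jint_eq_setIntegral_crossing f ?_ 2 1 ω fun q hq => ?_
      · unfold S3; measurability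
      · have h0 := hq 0; have h1 := hq 1; have h2 := hq 2; have h3 := hq 3
        simp only [freq_zero, freq_one, freq_two, freq_three] at *
        simp only [S3, crossing, mem_ofPred_eq, freq_one, freq_two]
        constructor
        · rintro ⟨_, _, _, _⟩; constructor <;> linarith
        · rintro ⟨_, _⟩; refine ⟨?_, ?_, ?_, ?_⟩ <;> linarith
  · refine Jint_eq_setIntegral_crossing f ?_ 3 0 ω fun q hq => ?_
    · unfold S4; measurability
    · have h0 := hq 0; have h1 := hq 1; have h2 := hq 2; have h3 := hq 3
      simp only [freq_zero, freq_one, freq_two, freq_three] at *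
      simp only [S4, crossing, mem_ofPred_eq, freq_zero, freq_three]
      constructor
      · rintro ⟨_, _, _, _⟩; constructor <;> linarith
      · rintro ⟨_, _⟩; refine ⟨?_, ?_, ?_, ?_⟩ <;> linarith

/-! ### The Kolmogorov–Zakharov density in scale-invariant coordinates -/

/-- The Kolmogorov–Zakharov spectrum of constant mass flux. -/
noncomputable def kz (σ : ℝ) : ℝ := σ ^ (-(7 : ℝ) / 6)

@[fun_prop]
lemma measurable_kz : Measurable kz := by
  unfold kz
  fun_prop

lemma kz_pos {σ : ℝ} (hσ : 0 < σ) : 0 < kz σ := Real.rpow_pos_of_pos hσ _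

lemma fluxDensity_congr {f g : ℝ → ℝ} (h : ∀ σ > 0, f σ = g σ) : fluxDensity f = fluxDensity g := by
  ext q
  by_cases h0 : minSqrt q.1 q.2.1 q.2.2 (q.1 + q.2.1 - q.2.2) = 0
  · simp [fluxDensity, h0]
  · have hp := freq_pos_of_minSqrt_ne_zero h0
    simp only [fluxDensity, h _ (hp 0), h _ (hp 1), h _ (hp 2),
      ← freq_zero q, ← freq_one q, ← freq_two q]

lemma fluxDensity_smul (f : ℝ → ℝ) {s : ℝ} (hs : 0 < s) (q : ℝ × ℝ × ℝ) :
    fluxDensity f (s • q) = (s ^ 3)⁻¹ * fluxDensity (fun σ => s ^ (7 / 6 : ℝ) * f (s * σ)) q := by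
  have hpow : √s * s ^ 3 = s ^ (7 / 6 : ℝ) * s ^ (7 / 6 : ℝ) * s ^ (7 / 6 : ℝ) := by
    rw [Real.sqrt_eq_rpow, ← Real.rpow_natCast, ← Real.rpow_add hs, ← Real.rpow_add hs,
      ← Real.rpow_add hs]
    norm_num
  simp only [fluxDensity, Prod.smul_fst, Prod.smul_snd, smul_eq_mul]
  rw [show s * q.1 + s * q.2.1 - s * q.2.2 = s * (q.1 + q.2.1 - q.2.2) by ring, minSqrt_mul hs.le]
  have h3 : s ^ 3 ≠ 0 := by positivity
  rw [eq_inv_mul_iff_mul_eq₀ h3]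
  linear_combination (minSqrt q.1 q.2.1 q.2.2 (q.1 + q.2.1 - q.2.2) * f (s * q.1) * f (s * q.2.1)
    * f (s * q.2.2)) * hpow

lemma rpow_mul_kz {s σ : ℝ} (hs : 0 < s) (hσ : 0 < σ) : s ^ (7 / 6 : ℝ) * kz (s * σ) = kz σ := by
  rw [kz, kz, Real.mul_rpow hs.le hσ.le, ← mul_assoc, ← Real.rpow_add hs]
  norm_num

lemma fluxDensity_kz_smul {s : ℝ} (hs : 0 < s) (q : ℝ × ℝ × ℝ) :
    fluxDensity kz (s • q) = (s ^ 3)⁻¹ * fluxDensity kz q := by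
  rw [fluxDensity_smul kz hs]
  rw [fluxDensity_congr fun σ hσ => rpow_mul_kz hs hσ]

lemma fluxDensity_kz_nonneg (q : ℝ × ℝ × ℝ) : 0 ≤ fluxDensity kz q := by
  by_cases h0 : fluxDensity kz q = 0
  · exact h0.ge
  · have hp := freq_pos_of_fluxDensity_ne_zero h0
    have h1 := kz_pos (hp 0)
    have h2 := kz_pos (hp 1)
    have h3 := kz_pos (hp 2)
    have := minSqrt_nonneg q.1 q.2.1 q.2.2 (q.1 + q.2.1 - q.2.2)
    simp only [freq_zero, freq_one, freq_two] at h1 h2 h3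
    unfold fluxDensity
    positivity

/-- The section `ω₁ + ω₂ = 1` of the cone of positive frequencies. -/
def sectionPoint (z : ℝ × ℝ) : ℝ × ℝ × ℝ := (z.1, 1 - z.1, z.2)

@[fun_prop]
lemma measurable_sectionPoint : Measurable sectionPoint := by
  unfold sectionPoint
  fun_prop

/-- The open unit square, which parametrises the positive part of the section. -/
def unitSquare : Set (ℝ × ℝ) := Ioo 0 1 ×ˢ Ioo 0 1

lemma measurableSet_unitSquare : MeasurableSet unitSquare := measurableSet_Ioo.prod measurableSet_Ioo

lemma freq_sectionPoint_bounds {z : ℝ × ℝ} (hz : z ∈ unitSquare) (i : Fin 4) :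
    z.1 * (1 - z.1) * (z.2 * (1 - z.2)) ≤ freq i (sectionPoint z) ∧
      freq i (sectionPoint z) ≤ 1 := by
  obtain ⟨x, y⟩ := z
  obtain ⟨⟨hx, hx'⟩, hy, hy'⟩ := hz
  dsimp only at *
  have hx1 : 0 < 1 - x := by linarith
  have hy1 : 0 < 1 - y := by linarith
  have ha : x * (1 - x) ≤ x := by nlinarith
  have ha' : x * (1 - x) ≤ 1 - x := by nlinarith
  have hb : y * (1 - y) ≤ y := by nlinarith
  have hb' : y * (1 - y) ≤ 1 - y := by nlinarith
  have hxx : 0 < x * (1 - x) := by positivity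
  have hyy : 0 < y * (1 - y) := by positivity
  have h1 : x * (1 - x) * (y * (1 - y)) ≤ x * (1 - x) := by nlinarith
  have h2 : x * (1 - x) * (y * (1 - y)) ≤ y * (1 - y) := by nlinarith
  fin_cases i <;> simp [freq, sectionPoint] <;> constructor <;> linarith

lemma freq_sectionPoint_pos {z : ℝ × ℝ} (hz : z ∈ unitSquare) (i : Fin 4) :
    0 < freq i (sectionPoint z) := by
  obtain ⟨⟨_, _⟩, _, _⟩ := hz
  fin_cases i <;> simp [freq, sectionPoint] <;> linarith

lemma mem_unitSquare_of_freq_pos {z : ℝ × ℝ} (h : ∀ i, 0 < freq i (sectionPoint z)) :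
    z ∈ unitSquare := by
  have h0 := h 0; have h1 := h 1; have h2 := h 2; have h3 := h 3
  simp [sectionPoint] at h0 h1 h2 h3
  exact ⟨⟨h0, h1⟩, h2, h3⟩

/-- Integration over the cone of positive frequencies in the coordinates
`(ω₁, ω₂, ω₃) = s (x, 1 - x, y)`. -/
lemma lintegral_eq_lintegral_section {H : ℝ × ℝ × ℝ → ENNReal} (hH : Measurable H)
    (h0 : ∀ q, H q ≠ 0 → ∀ i, 0 < freq i q) :
    ∫⁻ q, H q = ∫⁻ z in unitSquare, ∫⁻ s in Ioi (0 : ℝ),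
      ENNReal.ofReal (s ^ 2) * H (s • sectionPoint z) := by
  have hscale : ∀ s > (0 : ℝ), ∫⁻ z : ℝ × ℝ, H (z.1, s - z.1, z.2)
      = ∫⁻ z : ℝ × ℝ, ENNReal.ofReal (s ^ 2) * H (s • sectionPoint z) := by
    intro s hs
    rw [lintegral_const_mul _ (by fun_prop)]
    have hmap := Measure.map_addHaar_smul (volume : Measure (ℝ × ℝ)) hs.ne'
    have hg : Measurable fun z : ℝ × ℝ => H (z.1, s - z.1, z.2) := by fun_prop
    have := congrArg (fun μ => ∫⁻ z, H (z.1, s - z.1, z.2) ∂μ) hmap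
    simp only [lintegral_smul_measure, smul_eq_mul] at this
    rw [lintegral_map hg (measurable_const_smul s)] at this
    have hpt : ∀ z : ℝ × ℝ, s • sectionPoint z = ((s • z).1, s - (s • z).1, (s • z).2) := by
      intro z
      simp [sectionPoint, mul_sub]
    simp only [hpt, this]
    rw [← mul_assoc, ← ENNReal.ofReal_mul (by positivity)]
    have hfin : Module.finrank ℝ (ℝ × ℝ) = 2 := by simp
    rw [hfin, abs_of_pos (by positivity), mul_inv_cancel₀ (by positivity)]
    simp
  have hneg : ∀ s ∉ Ioi (0 : ℝ), ∫⁻ z : ℝ × ℝ, H (z.1, s - z.1, z.2) = 0 := by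
    intro s hs
    refine lintegral_eq_zero_of_ae_eq_zero (Eventually.of_forall fun z => ?_)
    by_contra hne
    have h1 := h0 _ hne 0
    have h2 := h0 _ hne 1
    simp at h1 h2 hs
    linarith
  have hzero : ∀ z ∉ unitSquare, ∫⁻ s in Ioi (0 : ℝ),
      ENNReal.ofReal (s ^ 2) * H (s • sectionPoint z) = 0 := by
    intro z hz
    refine (setLIntegral_congr_fun measurableSet_Ioi fun s hs => ?_).trans lintegral_zero
    by_contra hne
    refine hz (mem_unitSquare_of_freq_pos fun i => ?_)
    have := h0 _ (right_ne_zero_of_mul hne) i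
    rw [freq_smul] at this
    exact (mul_pos_iff_of_pos_left hs).1 this
  rw [← measurePreserving_total.lintegral_comp hH]
  change ∫⁻ q : ℝ × ℝ × ℝ, H (q.2.1, q.1 - q.2.1, q.2.2) ∂(volume.prod volume) = _
  rw [lintegral_prod _ (by fun_prop),
    ← setLIntegral_eq_of_support_subset fun s hs => by_contra fun h => hs (hneg s h),
    setLIntegral_congr_fun measurableSet_Ioi hscale, lintegral_lintegral_swap (by fun_prop),
    ← setLIntegral_eq_of_support_subset fun z hz => by_contra fun h => hz (hzero z h)]

lemma lintegral_inv_Ioo {u v : ℝ} (hu : 0 < u) (hv : 0 < v) :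
    ∫⁻ s in Ioo u v, ENNReal.ofReal s⁻¹ = ENNReal.ofReal (Real.log (v / u)) := by
  rcases le_or_gt u v with huv | huv
  · have hint : IntegrableOn (fun s : ℝ => s⁻¹) (Ioc u v) := by
      refine (intervalIntegrable_iff_integrableOn_Ioc_of_le huv).1 ?_
      refine intervalIntegral.intervalIntegrable_inv (fun x hx => ?_) continuousOn_id
      rw [uIcc_of_le huv] at hx
      exact (hu.trans_le hx.1).ne'
    rw [← integral_inv_of_pos hu hv, intervalIntegral.integral_of_le huv,
      ofReal_integral_eq_lintegral_ofReal hint, restrict_Ioo_eq_restrict_Ioc]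
    exact (ae_restrict_mem measurableSet_Ioc).mono fun s hs => inv_nonneg.2 (hu.trans hs.1).le
  · rw [Ioo_eq_empty huv.not_gt, ENNReal.ofReal_of_nonpos]
    · simp
    · exact Real.log_nonpos (by positivity) ((div_le_one hu).2 huv.le)

/-- Integral of the Kolmogorov–Zakharov density over a set whose rays are intervals. -/
lemma setLIntegral_fluxDensity_kz {A : Set (ℝ × ℝ × ℝ)} (hA : MeasurableSet A) (u v : ℝ × ℝ → ℝ)
    (hu : ∀ z ∈ unitSquare, 0 < u z) (hv : ∀ z ∈ unitSquare, 0 < v z)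
    (hray : ∀ z ∈ unitSquare, ∀ s > 0, s • sectionPoint z ∈ A ↔ u z < s ∧ s < v z) :
    ∫⁻ q in A, ENNReal.ofReal (fluxDensity kz q) = ∫⁻ z in unitSquare,
      ENNReal.ofReal (fluxDensity kz (sectionPoint z)) * ENNReal.ofReal (Real.log (v z / u z)) := by
  rw [← lintegral_indicator hA, lintegral_eq_lintegral_section]
  · refine setLIntegral_congr_fun measurableSet_unitSquare fun z hz => ?_
    rw [← lintegral_inv_Ioo (hu z hz) (hv z hz), ← lintegral_const_mul _ (by fun_prop),
      ← lintegral_indicator measurableSet_Ioo, ← lintegral_indicator measurableSet_Ioi]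
    congr 1 with s
    by_cases hs : 0 < s
    · rw [indicator_of_mem (show s ∈ Ioi 0 from hs)]
      by_cases hsz : s • sectionPoint z ∈ A
      · rw [indicator_of_mem hsz, indicator_of_mem (show s ∈ Ioo _ _ from (hray z hz s hs).1 hsz),
          fluxDensity_kz_smul hs, ← ENNReal.ofReal_mul (by positivity),
          ← ENNReal.ofReal_mul (fluxDensity_kz_nonneg _)]
        congr 1
        field_simp
      · rw [indicator_of_notMem hsz,
          indicator_of_notMem (show s ∉ Ioo _ _ from mt (hray z hz s hs).2 hsz), mul_zero]
    · rw [indicator_of_notMem (show s ∉ Ioi 0 from hs),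
        indicator_of_notMem (show s ∉ Ioo _ _ from fun h => hs ((hu z hz).trans h.1))]
  · exact Measurable.indicator (by fun_prop) hA
  · intro q hq
    refine freq_pos_of_fluxDensity_ne_zero (f := kz) fun h => hq ?_
    simp [indicator, h]

lemma integrableOn_mul_one_sub_rpow {r : ℝ} (hr : -1 < r) (hr' : r ≤ 0) :
    IntegrableOn (fun t : ℝ => (t * (1 - t)) ^ r) (Ioo 0 1) := by
  have h1 : IntegrableOn (fun t : ℝ => t ^ r) (Ioo 0 1) :=
    ((intervalIntegrable_iff_integrableOn_Ioo_of_le zero_le_one).1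
      (intervalIntegral.intervalIntegrable_rpow' hr))
  have h2 : IntegrableOn (fun t : ℝ => (1 - t) ^ r) (Ioo 0 1) := by
    refine (intervalIntegrable_iff_integrableOn_Ioo_of_le zero_le_one).1 ?_
    have := (intervalIntegral.intervalIntegrable_rpow' hr (a := 1) (b := 0)).comp_sub_left 1
    simpa using this
  refine Integrable.mono' ((h1.add h2).const_mul (2 ^ (-r)))
    (by fun_prop : Measurable _).aestronglyMeasurable ?_
  refine (ae_restrict_mem measurableSet_Ioo).mono fun t ht => ?_
  obtain ⟨h0, h1⟩ := ht
  have h1' : 0 < 1 - t := by linarith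
  have ha : 0 < t ^ r := by positivity
  have hb : 0 < (1 - t) ^ r := by positivity
  have key : ∀ x : ℝ, 1 / 2 ≤ x → x ^ r ≤ 2 ^ (-r) := by
    intro x hx
    rw [Real.rpow_neg zero_le_two, ← Real.inv_rpow zero_le_two]
    exact Real.rpow_le_rpow_of_nonpos (by norm_num) (by linarith) hr'
  have hc : (0 : ℝ) < 2 ^ (-r) := by positivity
  rw [Real.norm_of_nonneg (by positivity), Real.mul_rpow h0.le h1'.le]
  simp only [Pi.add_apply]
  rcases le_total t (1 / 2) with h | h
  · have := key (1 - t) (by linarith)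
    nlinarith
  · have := key t h
    nlinarith

lemma integrableOn_unitSquare_rpow {r : ℝ} (hr : -1 < r) (hr' : r ≤ 0) :
    IntegrableOn (fun z : ℝ × ℝ => (z.1 * (1 - z.1) * (z.2 * (1 - z.2))) ^ r) unitSquare := by
  have h := integrableOn_mul_one_sub_rpow hr hr'
  have hprod := Integrable.mul_prod h h
  rw [Measure.prod_restrict] at hprod
  refine (integrableOn_congr_fun (fun z hz => ?_) measurableSet_unitSquare).1 hprod
  obtain ⟨⟨h1, h2⟩, h3, h4⟩ := hz
  exact (Real.mul_rpow (by nlinarith) (by nlinarith)).symm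

lemma minSqrt_le_rpow {x y : ℝ} (hx : x ∈ Ioo 0 1) (hy : y ∈ Ioo 0 1) :
    minSqrt x (1 - x) y (1 - y) ≤ 2 * (x * (1 - x) * (y * (1 - y))) ^ (1 / 4 : ℝ) := by
  obtain ⟨hx0, hx1⟩ := hx
  obtain ⟨hy0, hy1⟩ := hy
  have key : ∀ t : ℝ, 0 < t → t < 1 → min √t √(1 - t) ^ 2 ≤ 2 * (t * (1 - t)) := by
    intro t h0 h1
    rcases le_total t (1 / 2) with h | h
    · rw [min_eq_left (Real.sqrt_le_sqrt (by linarith)), Real.sq_sqrt h0.le]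
      nlinarith
    · rw [min_eq_right (Real.sqrt_le_sqrt (by linarith)), Real.sq_sqrt (by linarith)]
      nlinarith
  have hm : 0 ≤ x * (1 - x) * (y * (1 - y)) := by
    have : 0 < 1 - x := by linarith
    have : 0 < 1 - y := by linarith
    positivity
  have h0 := minSqrt_nonneg x (1 - x) y (1 - y)
  have hl : minSqrt x (1 - x) y (1 - y) ^ 2 ≤ 2 * (x * (1 - x)) :=
    (pow_le_pow_left₀ h0 (min_le_left _ _) 2).trans (key x hx0 hx1)
  have hr : minSqrt x (1 - x) y (1 - y) ^ 2 ≤ 2 * (y * (1 - y)) :=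
    (pow_le_pow_left₀ h0 (min_le_right _ _) 2).trans (key y hy0 hy1)
  refine le_of_pow_le_pow_left₀ four_ne_zero (by positivity) ?_
  rw [mul_pow, ← Real.rpow_natCast (_ ^ (1 / 4 : ℝ)), ← Real.rpow_mul hm]
  norm_num
  have := mul_le_mul hl hr (by positivity) (by nlinarith)
  nlinarith

lemma fluxDensity_kz_sectionPoint_le {z : ℝ × ℝ} (hz : z ∈ unitSquare) :
    fluxDensity kz (sectionPoint z) ≤
      2 * (z.1 * (1 - z.1) * (z.2 * (1 - z.2))) ^ (-(11 : ℝ) / 12) := by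
  obtain ⟨x, y⟩ := z
  obtain ⟨hx, hy⟩ := hz
  have hmin := minSqrt_le_rpow hx hy
  obtain ⟨hx0, hx1⟩ := hx
  obtain ⟨hy0, hy1⟩ := hy
  dsimp only at *
  have hx' : 0 < 1 - x := by linarith
  have hy' : 0 < 1 - y := by linarith
  have hone : 1 ≤ kz (1 - y) :=
    Real.one_le_rpow_of_pos_of_le_one_of_nonpos hy' (by linarith) (by norm_num)
  have hpx := kz_pos hx0
  have hpx' := kz_pos hx'
  have hpy := kz_pos hy0
  have hm : 0 < x * (1 - x) * (y * (1 - y)) := by positivity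
  have hmul : kz x * kz (1 - x) * kz y * kz (1 - y) =
      (x * (1 - x) * (y * (1 - y))) ^ (-(7 : ℝ) / 6) := by
    simp only [kz]
    rw [Real.mul_rpow (by positivity) (by positivity), Real.mul_rpow hx0.le hx'.le,
      Real.mul_rpow hy0.le hy'.le]
    ring
  calc fluxDensity kz (sectionPoint (x, y))
      = minSqrt x (1 - x) y (1 - y) * (kz x * kz (1 - x) * kz y) := by
        simp [fluxDensity, sectionPoint]; ring
    _ ≤ 2 * (x * (1 - x) * (y * (1 - y))) ^ (1 / 4 : ℝ) *
          (kz x * kz (1 - x) * kz y * kz (1 - y)) :=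
        mul_le_mul hmin (le_mul_of_one_le_right (by positivity) hone) (by positivity)
          (by positivity)
    _ = _ := by
        rw [hmul, mul_assoc, ← Real.rpow_add hm]
        norm_num

lemma abs_log_freq_div_le {z : ℝ × ℝ} (hz : z ∈ unitSquare) (i j : Fin 4) :
    |Real.log (freq j (sectionPoint z) / freq i (sectionPoint z))| ≤
      24 * (z.1 * (1 - z.1) * (z.2 * (1 - z.2))) ^ (-(1 : ℝ) / 24) := by
  set m := z.1 * (1 - z.1) * (z.2 * (1 - z.2)) with hm
  have hm0 : 0 < m := by
    obtain ⟨⟨h1, h2⟩, h3, h4⟩ := hz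
    have : 0 < 1 - z.1 := by linarith
    have : 0 < 1 - z.2 := by linarith
    positivity
  have hbound : ∀ k, Real.log m ≤ Real.log (freq k (sectionPoint z)) ∧
      Real.log (freq k (sectionPoint z)) ≤ 0 := fun k =>
    ⟨Real.log_le_log hm0 (freq_sectionPoint_bounds hz k).1,
      Real.log_nonpos (freq_sectionPoint_pos hz k).le (freq_sectionPoint_bounds hz k).2⟩
  have hlog : -Real.log m ≤ 24 * m ^ (-(1 : ℝ) / 24) := by
    have := Real.log_le_rpow_div (inv_nonneg.2 hm0.le) (show (0 : ℝ) < 1 / 24 by norm_num)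
    rw [Real.log_inv, Real.inv_rpow hm0.le, ← Real.rpow_neg hm0.le] at this
    refine this.trans_eq ?_
    rw [neg_div]
    ring
  refine le_trans ?_ hlog
  rw [Real.log_div (freq_sectionPoint_pos hz j).ne' (freq_sectionPoint_pos hz i).ne', abs_le]
  constructor <;> linarith [hbound i, hbound j, (hbound i).1, (hbound j).1, (hbound i).2,
    (hbound j).2]

lemma integrableOn_fluxDensity_kz_section :
    IntegrableOn (fun z => fluxDensity kz (sectionPoint z)) unitSquare := by
  refine Integrable.mono' ((integrableOn_unitSquare_rpow (r := -(11 : ℝ) / 12) (by norm_num)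
    (by norm_num)).const_mul 2) (by fun_prop : Measurable _).aestronglyMeasurable ?_
  refine (ae_restrict_mem measurableSet_unitSquare).mono fun z hz => ?_
  rw [Real.norm_of_nonneg (fluxDensity_kz_nonneg _)]
  exact fluxDensity_kz_sectionPoint_le hz

lemma integrableOn_fluxDensity_kz_section_mul_log (i j : Fin 4) :
    IntegrableOn (fun z => fluxDensity kz (sectionPoint z) *
      Real.log (freq j (sectionPoint z) / freq i (sectionPoint z))) unitSquare := by
  refine Integrable.mono' ((integrableOn_unitSquare_rpow (r := -(23 : ℝ) / 24) (by norm_num)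
    (by norm_num)).const_mul 48) (by fun_prop) ?_
  refine (ae_restrict_mem measurableSet_unitSquare).mono fun z hz => ?_
  rw [norm_mul, Real.norm_of_nonneg (fluxDensity_kz_nonneg _), Real.norm_eq_abs]
  have hm0 : 0 < z.1 * (1 - z.1) * (z.2 * (1 - z.2)) := by
    obtain ⟨⟨h1, h2⟩, h3, h4⟩ := hz
    have : 0 < 1 - z.1 := by linarith
    have : 0 < 1 - z.2 := by linarith
    positivity
  refine (mul_le_mul (fluxDensity_kz_sectionPoint_le hz) (abs_log_freq_div_le hz i j)
    (abs_nonneg _) (by positivity)).trans_eq ?_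
  rw [show (-(23 : ℝ) / 24) = -(11 : ℝ) / 12 + -(1 : ℝ) / 24 by norm_num, Real.rpow_add hm0]
  ring

lemma setLIntegral_fluxDensity_kz_crossing (i j : Fin 4) {ω : ℝ} (hω : 0 < ω) :
    ∫⁻ q in crossing i j ω, ENNReal.ofReal (fluxDensity kz q) = ∫⁻ z in unitSquare,
      ENNReal.ofReal (fluxDensity kz (sectionPoint z)) *
        ENNReal.ofReal (Real.log (freq j (sectionPoint z) / freq i (sectionPoint z))) := by
  rw [setLIntegral_fluxDensity_kz (measurableSet_crossing i j ω)
    (fun z => ω / freq j (sectionPoint z)) (fun z => ω / freq i (sectionPoint z))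
    (fun z hz => div_pos hω (freq_sectionPoint_pos hz j))
    (fun z hz => div_pos hω (freq_sectionPoint_pos hz i))]
  · refine setLIntegral_congr_fun measurableSet_unitSquare fun z hz => ?_
    have hi := freq_sectionPoint_pos hz i
    have hj := freq_sectionPoint_pos hz j
    congr 3
    field_simp
  · intro z hz s hs
    simp only [crossing, mem_ofPred_eq, freq_smul]
    rw [div_lt_iff₀ (freq_sectionPoint_pos hz j), lt_div_iff₀ (freq_sectionPoint_pos hz i)]
    exact and_comm

lemma integrableOn_of_setLIntegral_ofReal_lt_top {A : Set (ℝ × ℝ × ℝ)}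
    (h : ∫⁻ q in A, ENNReal.ofReal (fluxDensity kz q) < ⊤) : IntegrableOn (fluxDensity kz) A := by
  refine ⟨by fun_prop, ?_⟩
  rwa [hasFiniteIntegral_iff_ofReal (Eventually.of_forall fluxDensity_kz_nonneg)]

lemma integrableOn_fluxDensity_kz_crossing (i j : Fin 4) {ω : ℝ} (hω : 0 < ω) :
    IntegrableOn (fluxDensity kz) (crossing i j ω) := by
  refine integrableOn_of_setLIntegral_ofReal_lt_top ?_
  rw [setLIntegral_fluxDensity_kz_crossing i j hω]
  refine lt_of_le_of_lt (lintegral_mono fun z => ?_)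
    (integrableOn_fluxDensity_kz_section_mul_log i j).2
  rw [← ENNReal.ofReal_mul (fluxDensity_kz_nonneg _)]
  exact Real.ofReal_le_enorm _

/-- The set of quadruples whose `i`-th frequency lies in `(a, b)`. -/
def slab (i : Fin 4) (a b : ℝ) : Set (ℝ × ℝ × ℝ) := freq i ⁻¹' Ioo a b

lemma measurableSet_slab (i : Fin 4) (a b : ℝ) : MeasurableSet (slab i a b) :=
  measurable_freq i measurableSet_Ioo

lemma integrableOn_fluxDensity_kz_slab (i : Fin 4) {a b : ℝ} (ha : 0 < a) (hb : 0 < b) :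
    IntegrableOn (fluxDensity kz) (slab i a b) := by
  refine integrableOn_of_setLIntegral_ofReal_lt_top ?_
  rw [setLIntegral_fluxDensity_kz (measurableSet_slab i a b)
    (fun z => a / freq i (sectionPoint z)) (fun z => b / freq i (sectionPoint z))
    (fun z hz => div_pos ha (freq_sectionPoint_pos hz i))
    (fun z hz => div_pos hb (freq_sectionPoint_pos hz i))]
  · rw [setLIntegral_congr_fun measurableSet_unitSquare
      (g := fun z => ENNReal.ofReal (fluxDensity kz (sectionPoint z)) *
        ENNReal.ofReal (Real.log (b / a))), lintegral_mul_const _ (by fun_prop)]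
    · refine ENNReal.mul_lt_top ?_ ENNReal.ofReal_lt_top
      exact (lintegral_mono fun z => Real.ofReal_le_enorm _).trans_lt
        integrableOn_fluxDensity_kz_section.2
    · intro z hz
      have hi := freq_sectionPoint_pos hz i
      dsimp only
      congr 3
      field_simp
  · intro z hz s hs
    simp only [slab, mem_preimage, mem_Ioo, freq_smul]
    rw [div_lt_iff₀ (freq_sectionPoint_pos hz i), lt_div_iff₀ (freq_sectionPoint_pos hz i)]

/-! ### Negativity of the Kolmogorov–Zakharov flux -/

lemma setIntegral_fluxDensity_kz_crossing (i j : Fin 4) {ω : ℝ} (hω : 0 < ω) :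
    ∫ q in crossing i j ω, fluxDensity kz q = ∫ z in unitSquare,
      fluxDensity kz (sectionPoint z) *
        max (Real.log (freq j (sectionPoint z) / freq i (sectionPoint z))) 0 := by
  rw [integral_eq_lintegral_of_nonneg_ae (Eventually.of_forall fluxDensity_kz_nonneg)
      (by fun_prop : Measurable _).aestronglyMeasurable,
    integral_eq_lintegral_of_nonneg_ae (Eventually.of_forall fun z =>
      mul_nonneg (fluxDensity_kz_nonneg _) (le_max_right _ _))
      (by fun_prop : Measurable _).aestronglyMeasurable,
    setLIntegral_fluxDensity_kz_crossing i j hω]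
  congr 2 with z
  rw [ENNReal.ofReal_mul (fluxDensity_kz_nonneg _), ENNReal.ofReal_max, ENNReal.ofReal_zero,
    max_eq_left zero_le]

lemma setIntegral_crossing_sub_swap (i j : Fin 4) {ω : ℝ} (hω : 0 < ω) :
    (∫ q in crossing i j ω, fluxDensity kz q) - ∫ q in crossing j i ω, fluxDensity kz q =
      ∫ z in unitSquare, fluxDensity kz (sectionPoint z) *
        Real.log (freq j (sectionPoint z) / freq i (sectionPoint z)) := by
  have hint : ∀ i j, IntegrableOn (fun z => fluxDensity kz (sectionPoint z) *
        max (Real.log (freq j (sectionPoint z) / freq i (sectionPoint z))) 0) unitSquare := by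
    intro i j
    refine Integrable.mono (integrableOn_fluxDensity_kz_section_mul_log i j)
      (by fun_prop : Measurable _).aestronglyMeasurable (Eventually.of_forall fun z => ?_)
    rw [norm_mul, norm_mul]
    refine mul_le_mul_of_nonneg_left ?_ (norm_nonneg _)
    rw [Real.norm_of_nonneg (le_max_right _ _)]
    exact max_le (le_abs_self _) (abs_nonneg _)
  rw [setIntegral_fluxDensity_kz_crossing i j hω, setIntegral_fluxDensity_kz_crossing j i hω,
    ← integral_sub (hint i j) (hint j i)]
  congr 1 with z
  rw [← mul_sub, ← inv_div (freq j _) (freq i _), Real.log_inv]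
  congr 1
  rcases le_total 0 (Real.log (freq j (sectionPoint z) / freq i (sectionPoint z))) with h | h
  · rw [max_eq_left h, max_eq_right (neg_nonpos.2 h), sub_zero]
  · rw [max_eq_right h, max_eq_left (neg_nonneg.2 h)]
    ring

lemma mem_unitSquare_of_fluxDensity_ne_zero {f : ℝ → ℝ} {z : ℝ × ℝ}
    (h : fluxDensity f (sectionPoint z) ≠ 0) : z ∈ unitSquare :=
  mem_unitSquare_of_freq_pos (freq_pos_of_fluxDensity_ne_zero h)

/-- The flux integrand of the Kolmogorov–Zakharov spectrum on the section `ω₁ + ω₂ = 1`. -/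
noncomputable def sectionFlux (z : ℝ × ℝ) : ℝ :=
  fluxDensity kz (sectionPoint z) *
    (Real.log z.2 + Real.log (1 - z.2) - (Real.log z.1 + Real.log (1 - z.1)))

lemma sectionFlux_eq {z : ℝ × ℝ} (hz : z ∈ unitSquare) :
    sectionFlux z = fluxDensity kz (sectionPoint z) *
        Real.log (freq 2 (sectionPoint z) / freq 1 (sectionPoint z)) +
      fluxDensity kz (sectionPoint z) *
        Real.log (freq 3 (sectionPoint z) / freq 0 (sectionPoint z)) := by
  have h := fun i => (freq_sectionPoint_pos hz i).ne'
  rw [Real.log_div (h 2) (h 1), Real.log_div (h 3) (h 0), sectionFlux]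
  simp [sectionPoint]
  ring

lemma sectionFlux_eq_zero {z : ℝ × ℝ} (hz : z ∉ unitSquare) : sectionFlux z = 0 := by
  rw [sectionFlux, not_imp_comm.1 mem_unitSquare_of_fluxDensity_ne_zero hz, zero_mul]

lemma integrable_sectionFlux : Integrable sectionFlux := by
  rw [← integrableOn_iff_integrable_of_support_subset
    (s := unitSquare) (fun z hz => by_contra fun h => hz (sectionFlux_eq_zero h))]
  exact (integrableOn_congr_fun (fun z hz => sectionFlux_eq hz) measurableSet_unitSquare).2
    ((integrableOn_fluxDensity_kz_section_mul_log 1 2).add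
      (integrableOn_fluxDensity_kz_section_mul_log 0 3))

lemma JM_kz_eq_integral_sectionFlux {ω : ℝ} (hω : 0 < ω) : JM kz ω = ∫ z, sectionFlux z := by
  rw [← setIntegral_eq_integral_of_forall_compl_eq_zero fun z hz => sectionFlux_eq_zero hz,
    setIntegral_congr_fun measurableSet_unitSquare fun z hz => sectionFlux_eq hz,
    integral_add (integrableOn_fluxDensity_kz_section_mul_log 1 2)
      (integrableOn_fluxDensity_kz_section_mul_log 0 3),
    ← setIntegral_crossing_sub_swap 1 2 hω, ← setIntegral_crossing_sub_swap 0 3 hω,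
    JM_eq_crossing]
  ring

lemma rpow_add_rpow_one_sub_lt {p x y : ℝ} (hp : 1 < p) (hx : x ∈ Ioo 0 1)
    (h : x * (1 - x) < y * (1 - y)) : y ^ p + (1 - y) ^ p < x ^ p + (1 - x) ^ p := by
  have hprod : 0 < (1 - x - y) * (y - x) := by nlinarith
  have hne : 1 - 2 * x ≠ 0 := by
    intro h0
    obtain rfl : x = 1 / 2 := by linarith
    nlinarith [sq_nonneg (y - 1 / 2)]
  have ht : 0 < (1 - x - y) / (1 - 2 * x) ∧ 0 < (y - x) / (1 - 2 * x) := by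
    rcases (mul_pos_iff.1 hprod) with ⟨h1, h2⟩ | ⟨h1, h2⟩
    · have : 0 < 1 - 2 * x := by linarith
      exact ⟨div_pos h1 this, div_pos h2 this⟩
    · have : 1 - 2 * x < 0 := by linarith
      exact ⟨div_pos_of_neg_of_neg h1 this, div_pos_of_neg_of_neg h2 this⟩
  have hsum : (1 - x - y) / (1 - 2 * x) + (y - x) / (1 - 2 * x) = 1 := by
    rw [← add_div, div_eq_one_iff_eq hne]
    ring
  have hxm : x ∈ Ici (0 : ℝ) := hx.1.le
  have hxm' : 1 - x ∈ Ici (0 : ℝ) := by simpa using hx.2.le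
  have hxx : x ≠ 1 - x := fun h0 => hne (by linarith)
  have h1 := (strictConvexOn_rpow hp).2 hxm hxm' hxx ht.1 ht.2 hsum
  have h2 := (strictConvexOn_rpow hp).2 hxm' hxm hxx.symm ht.1 ht.2 hsum
  simp only [smul_eq_mul] at h1 h2
  have e1 : (1 - x - y) / (1 - 2 * x) * x + (y - x) / (1 - 2 * x) * (1 - x) = y := by
    rw [div_mul_eq_mul_div, div_mul_eq_mul_div, ← add_div, div_eq_iff hne]
    ring
  have e2 : (1 - x - y) / (1 - 2 * x) * (1 - x) + (y - x) / (1 - 2 * x) * x = 1 - y := by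
    rw [div_mul_eq_mul_div, div_mul_eq_mul_div, ← add_div, div_eq_iff hne]
    ring
  rw [e1] at h1
  rw [e2] at h2
  linear_combination h1 + h2 + (x ^ p + (1 - x) ^ p) * hsum

/-- The sum of `sectionFlux` over the symmetries of the four-wave interaction. -/
noncomputable def symmetrizedFlux (z : ℝ × ℝ) : ℝ :=
  sectionFlux z + sectionFlux (z.1, 1 - z.2) + sectionFlux z.swap + sectionFlux (z.2, 1 - z.1)

lemma minSqrt_swap_left (a b c d : ℝ) : minSqrt b a c d = minSqrt a b c d := by
  simp only [minSqrt, min_comm]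

lemma minSqrt_swap_right (a b c d : ℝ) : minSqrt a b d c = minSqrt a b c d := by
  simp only [minSqrt, min_comm]

lemma minSqrt_swap_pairs (a b c d : ℝ) : minSqrt c d a b = minSqrt a b c d := by
  simp only [minSqrt, min_comm]

lemma symmetrizedFlux_eq {x y : ℝ} (hx : x ∈ Ioo 0 1) (hy : y ∈ Ioo 0 1) :
    symmetrizedFlux (x, y) =
      minSqrt x (1 - x) y (1 - y) * (kz x * kz (1 - x) * kz y * kz (1 - y)) *
        ((y ^ (7 / 6 : ℝ) + (1 - y) ^ (7 / 6 : ℝ) - (x ^ (7 / 6 : ℝ) + (1 - x) ^ (7 / 6 : ℝ))) *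
          (Real.log (y * (1 - y)) - Real.log (x * (1 - x)))) := by
  have hinv : ∀ t : ℝ, 0 < t → kz t * t ^ (7 / 6 : ℝ) = 1 := by
    intro t ht
    rw [kz, ← Real.rpow_add ht]
    norm_num
  have hx' : 0 < 1 - x := sub_pos.2 hx.2
  have hy' : 0 < 1 - y := sub_pos.2 hy.2
  rw [Real.log_mul hy.1.ne' hy'.ne', Real.log_mul hx.1.ne' hx'.ne']
  have e : ∀ a b : ℝ, a + (1 - a) - b = 1 - b := fun a b => by ring
  simp only [symmetrizedFlux, sectionFlux, fluxDensity, sectionPoint, Prod.swap, e,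
    sub_sub_cancel]
  rw [minSqrt_swap_right x (1 - x) y (1 - y), minSqrt_swap_right y (1 - y) x (1 - x),
    minSqrt_swap_pairs x (1 - x) y (1 - y)]
  have h1 := hinv x hx.1
  have h2 := hinv y hy.1
  have h3 := hinv _ hx'
  have h4 := hinv _ hy'
  set L := Real.log y + Real.log (1 - y) - (Real.log x + Real.log (1 - x))
  set N := minSqrt x (1 - x) y (1 - y)
  linear_combination (N * L * kz (1 - x) * kz y * kz (1 - y)) * h1
    + (N * L * kz x * kz y * kz (1 - y)) * h3
    - (N * L * kz x * kz (1 - x) * kz (1 - y)) * h2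
    - (N * L * kz x * kz (1 - x) * kz y) * h4

lemma symmetrizedFlux_neg {x y : ℝ} (hx : x ∈ Ioo 0 1) (hy : y ∈ Ioo 0 1)
    (h : x * (1 - x) ≠ y * (1 - y)) : symmetrizedFlux (x, y) < 0 := by
  rw [symmetrizedFlux_eq hx hy]
  have hx' : 0 < 1 - x := sub_pos.2 hx.2
  have hy' : 0 < 1 - y := sub_pos.2 hy.2
  have hN : 0 < minSqrt x (1 - x) y (1 - y) := minSqrt_pos.2 ⟨hx.1, hx', hy.1, hy'⟩
  have := kz_pos hx.1
  have := kz_pos hy.1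
  have := kz_pos hx'
  have := kz_pos hy'
  refine mul_neg_of_pos_of_neg (by positivity) ?_
  rcases lt_or_gt_of_ne h with h | h
  · exact mul_neg_of_neg_of_pos
      (sub_neg.2 (rpow_add_rpow_one_sub_lt (by norm_num) hx h))
      (sub_pos.2 (Real.log_lt_log (mul_pos hx.1 hx') h))
  · exact mul_neg_of_pos_of_neg
      (sub_pos.2 (rpow_add_rpow_one_sub_lt (by norm_num) hy h))
      (sub_neg.2 (Real.log_lt_log (mul_pos hy.1 hy') h))

lemma symmetrizedFlux_nonpos (z : ℝ × ℝ) : symmetrizedFlux z ≤ 0 := by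
  obtain ⟨x, y⟩ := z
  by_cases hz : (x, y) ∈ unitSquare
  · by_cases h : x * (1 - x) = y * (1 - y)
    · rw [symmetrizedFlux_eq hz.1 hz.2, h]
      simp
    · exact (symmetrizedFlux_neg hz.1 hz.2 h).le
  · have h2 : (x, 1 - y) ∉ unitSquare := by
      rintro ⟨h, h1, h2⟩
      simp only [sub_pos, sub_lt_self_iff] at h1 h2
      exact hz ⟨h, h2, h1⟩
    have h3 : (y, x) ∉ unitSquare := fun h => hz h.symm
    have h4 : (y, 1 - x) ∉ unitSquare := by
      rintro ⟨h, h1, h2⟩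
      simp only [sub_pos, sub_lt_self_iff] at h1 h2
      exact hz ⟨⟨h2, h1⟩, h⟩
    simp [symmetrizedFlux, sectionFlux_eq_zero hz, sectionFlux_eq_zero h2,
      sectionFlux_eq_zero h3, sectionFlux_eq_zero h4]

lemma measurePreserving_reflect : MeasurePreserving (fun z : ℝ × ℝ => (z.1, 1 - z.2)) :=
  (MeasurePreserving.id volume).prod (Measure.measurePreserving_sub_left volume (1 : ℝ))

lemma integrable_and_integral_comp {α β : Type*} [MeasurableSpace α] [MeasurableSpace β]
    {μ : Measure α} {ν : Measure β} {T : α → β} (hT : MeasurePreserving T μ ν) {g : β → ℝ}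
    (hg : Integrable g ν) :
    Integrable (fun x => g (T x)) μ ∧ ∫ x, g (T x) ∂μ = ∫ y, g y ∂ν := by
  refine ⟨(hT.integrable_comp hg.aestronglyMeasurable).2 hg, ?_⟩
  have := integral_map hT.measurable.aemeasurable (f := g)
    (by rw [hT.map_eq]; exact hg.aestronglyMeasurable)
  rw [← this, hT.map_eq]

lemma JM_kz_neg {ω : ℝ} (hω : 0 < ω) : JM kz ω < 0 := by
  have h1 := integrable_sectionFlux
  have hswap : MeasurePreserving (Prod.swap : ℝ × ℝ → ℝ × ℝ) := Measure.measurePreserving_swap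
  obtain ⟨i2, e2⟩ := integrable_and_integral_comp measurePreserving_reflect h1
  obtain ⟨i3, e3⟩ := integrable_and_integral_comp hswap h1
  obtain ⟨i4, e4⟩ := integrable_and_integral_comp hswap i2
  have hint : Integrable symmetrizedFlux := ((h1.add i2).add i3).add i4
  have hval : ∫ z, symmetrizedFlux z = 4 * ∫ z, sectionFlux z := by
    have a2 : ∫ z : ℝ × ℝ, (sectionFlux z + sectionFlux (z.1, 1 - z.2)) =
        (∫ z, sectionFlux z) + ∫ z, sectionFlux z := (integral_add h1 i2).trans (by rw [e2])
    have a3 : ∫ z : ℝ × ℝ, (sectionFlux z + sectionFlux (z.1, 1 - z.2) + sectionFlux z.swap) =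
        (∫ z, sectionFlux z) + (∫ z, sectionFlux z) + ∫ z, sectionFlux z :=
      (integral_add (h1.add i2) i3).trans (congrArg₂ (· + ·) a2 e3)
    have a4 : ∫ z, symmetrizedFlux z =
        (∫ z, sectionFlux z) + (∫ z, sectionFlux z) + (∫ z, sectionFlux z) +
          ∫ z, sectionFlux z :=
      (integral_add ((h1.add i2).add i3) i4).trans (congrArg₂ (· + ·) a3 (e4.trans e2))
    linarith
  have hpos : 0 < ∫ z, -symmetrizedFlux z := by
    rw [integral_pos_iff_support_of_nonneg (fun z => neg_nonneg.2 (symmetrizedFlux_nonpos z))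
      hint.neg]
    have hsub : Ioo (0 : ℝ) (1 / 4) ×ˢ Ioo (1 / 4 : ℝ) (1 / 2) ⊆
        Function.support fun z => -symmetrizedFlux z := by
      rintro ⟨x, y⟩ ⟨⟨hx0, hx1⟩, hy0, hy1⟩
      dsimp only at hx0 hx1 hy0 hy1
      refine neg_ne_zero.2 (symmetrizedFlux_neg ⟨hx0, by linarith⟩ ⟨by linarith, by linarith⟩ ?_).ne
      nlinarith
    refine lt_of_lt_of_le ?_ (measure_mono hsub)
    rw [Measure.volume_eq_prod, Measure.prod_prod, Real.volume_Ioo, Real.volume_Ioo]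
    norm_num
  rw [integral_neg, hval] at hpos
  rw [JM_kz_eq_integral_sectionFlux hω]
  linarith

/-! ### Flux increments and the collision operator -/

section Spectrum

variable {f : ℝ → ℝ} {M : ℝ}

lemma abs_le_mul_kz (hfE : ∀ ω > (0 : ℝ), ω ^ (7 / 6 : ℝ) * |f ω| ≤ M) {σ : ℝ} (hσ : 0 < σ) :
    |f σ| ≤ M * kz σ := by
  have hinv : kz σ * σ ^ (7 / 6 : ℝ) = 1 := by
    rw [kz, ← Real.rpow_add hσ]
    norm_num
  calc |f σ| = kz σ * (σ ^ (7 / 6 : ℝ) * |f σ|) := by rw [← mul_assoc, hinv, one_mul]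
    _ ≤ kz σ * M := mul_le_mul_of_nonneg_left (hfE σ hσ) (kz_pos hσ).le
    _ = M * kz σ := mul_comm _ _

lemma abs_fluxDensity_le (hfE : ∀ ω > (0 : ℝ), ω ^ (7 / 6 : ℝ) * |f ω| ≤ M)
    (q : ℝ × ℝ × ℝ) : |fluxDensity f q| ≤ M ^ 3 * fluxDensity kz q := by
  by_cases h0 : minSqrt q.1 q.2.1 q.2.2 (q.1 + q.2.1 - q.2.2) = 0
  · simp [fluxDensity, h0]
  · have hp := freq_pos_of_minSqrt_ne_zero h0
    have hM : 0 ≤ M := le_trans (by positivity) (hfE 1 one_pos)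
    have h1 := abs_le_mul_kz hfE (hp 0)
    have h2 := abs_le_mul_kz hfE (hp 1)
    have h3 := abs_le_mul_kz hfE (hp 2)
    have k1 := kz_pos (hp 0)
    have k2 := kz_pos (hp 1)
    have k3 := kz_pos (hp 2)
    simp only [freq_zero, freq_one, freq_two] at h1 h2 h3 k1 k2 k3
    have hN := minSqrt_nonneg q.1 q.2.1 q.2.2 (q.1 + q.2.1 - q.2.2)
    simp only [fluxDensity, abs_mul, abs_of_nonneg hN]
    calc _ ≤ minSqrt q.1 q.2.1 q.2.2 (q.1 + q.2.1 - q.2.2) * (M * kz q.1) * (M * kz q.2.1) *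
          (M * kz q.2.2) := by gcongr
      _ = _ := by ring

lemma integrableOn_fluxDensity_of_kz (hf : Measurable f)
    (hfE : ∀ ω > (0 : ℝ), ω ^ (7 / 6 : ℝ) * |f ω| ≤ M) {A : Set (ℝ × ℝ × ℝ)}
    (hA : IntegrableOn (fluxDensity kz) A) : IntegrableOn (fluxDensity f) A :=
  Integrable.mono' (hA.const_mul (M ^ 3)) (measurable_fluxDensity hf).aestronglyMeasurable
    (Eventually.of_forall (abs_fluxDensity_le hfE))

lemma ae_freq_ne (i : Fin 4) (ω : ℝ) : ∀ᵐ q : ℝ × ℝ × ℝ, freq i q ≠ ω := by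
  have h0 : ∀ᵐ q : ℝ × ℝ × ℝ, q.1 ≠ ω :=
    Measure.quasiMeasurePreserving_fst.ae (Measure.ae_ne volume ω)
  have h1 : ∀ᵐ q : ℝ × ℝ × ℝ, q.2.1 ≠ ω := measurePreserving_swap₁₂.quasiMeasurePreserving.ae h0
  have h2 : ∀ᵐ q : ℝ × ℝ × ℝ, q.2.2 ≠ ω := measurePreserving_swap₂₃.quasiMeasurePreserving.ae h1
  have h3 : ∀ᵐ q : ℝ × ℝ × ℝ, q.1 + q.2.1 - q.2.2 ≠ ω :=
    measurePreserving_swap₃₄.quasiMeasurePreserving.ae h2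
  fin_cases i
  exacts [h0, h1, h2, h3]

lemma crossing_increment {g : ℝ × ℝ × ℝ → ℝ} {a b : ℝ} (hab : a < b)
    (hcross : ∀ (i j : Fin 4) (ω : ℝ), 0 < ω → IntegrableOn g (crossing i j ω))
    (hslab : ∀ i : Fin 4, IntegrableOn g (slab i a b)) (ha : 0 < a) (i j : Fin 4) :
    ((∫ q in crossing i j b, g q) - ∫ q in crossing j i b, g q) -
      ((∫ q in crossing i j a, g q) - ∫ q in crossing j i a, g q) =
      (∫ q in slab i a b, g q) - ∫ q in slab j a b, g q := by
  have hb := ha.trans hab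
  have ic : ∀ i j ω, 0 < ω → Integrable ((crossing i j ω).indicator g) := fun i j ω hω =>
    (integrable_indicator_iff (measurableSet_crossing i j ω)).2 (hcross i j ω hω)
  have is : ∀ i, Integrable ((slab i a b).indicator g) := fun i =>
    (integrable_indicator_iff (measurableSet_slab i a b)).2 (hslab i)
  simp only [← integral_indicator (measurableSet_crossing _ _ _),
    ← integral_indicator (measurableSet_slab _ _ _)]
  rw [← integral_sub (ic i j b hb) (ic j i b hb), ← integral_sub (ic i j a ha) (ic j i a ha),
    ← integral_sub (is i) (is j)]
  refine (integral_sub ((ic i j b hb).sub (ic j i b hb))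
    ((ic i j a ha).sub (ic j i a ha))).symm.trans (integral_congr_ae ?_)
  filter_upwards [ae_freq_ne i a, ae_freq_ne i b, ae_freq_ne j a, ae_freq_ne j b] with q h1 h2 h3 h4
  classical
  simp only [Pi.sub_apply, indicator_apply, crossing, slab, mem_ofPred_eq, mem_preimage,
    mem_Ioo]
  grind

/-- The density of the weak collision operator, with `ω₂ = ω₃ + ω₄ - ω₁`. -/
noncomputable def collisionDensity (f : ℝ → ℝ) (r : ℝ × ℝ × ℝ) : ℝ :=
  minSqrt r.1 (r.2.1 + r.2.2 - r.1) r.2.1 r.2.2 *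
    ((f r.1 + f (r.2.1 + r.2.2 - r.1)) * f r.2.1 * f r.2.2 -
      (f r.2.1 + f r.2.2) * f r.1 * f (r.2.1 + r.2.2 - r.1))

lemma sqrt_mul_collisionOp (f : ℝ → ℝ) (ω : ℝ) :
    √ω * collisionOp f ω = ∫ p, collisionDensity f (ω, p) := by
  have hdens : ∀ p : ℝ × ℝ, √ω * collisionIntegrand f ω p = collisionDensity f (ω, p) := by
    intro p
    rw [collisionIntegrand, collisionDensity, ← mul_assoc, sqrt_mul_W]
  rw [collisionOp, ← integral_const_mul]
  simp only [hdens]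
  refine setIntegral_eq_integral_of_forall_compl_eq_zero fun p hp => ?_
  by_contra hne
  obtain ⟨-, h2, h3, h4⟩ := minSqrt_pos.1
    ((minSqrt_nonneg _ _ _ _).lt_of_ne' (left_ne_zero_of_mul hne))
  exact hp ⟨h3.le, h4.le, h2.le⟩

lemma collisionDensity_eq (f : ℝ → ℝ) (r : ℝ × ℝ × ℝ) :
    collisionDensity f r =
      fluxDensity f (r.2.1, r.2.2, r.1) + fluxDensity f (r.2.1, r.2.2, r.2.1 + r.2.2 - r.1) -
      fluxDensity f (r.1, r.2.1 + r.2.2 - r.1, r.2.2) -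
      fluxDensity f (r.2.1 + r.2.2 - r.1, r.1, r.2.1) := by
  obtain ⟨a, c, d⟩ := r
  simp only [fluxDensity, collisionDensity]
  rw [show c + d - (c + d - a) = a by ring, show a + (c + d - a) - d = c by ring,
    show c + d - a + a - c = d by ring]
  rw [minSqrt_swap_pairs a (c + d - a) c d, minSqrt_swap_left a (c + d - a) c d,
    minSqrt_swap_right c d a (c + d - a), minSqrt_swap_pairs a (c + d - a) c d,
    minSqrt_swap_right a (c + d - a) c d]
  ring

lemma slab_comp {T : ℝ × ℝ × ℝ → ℝ × ℝ × ℝ} (hT : MeasurePreserving T) {i : Fin 4}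
    (hTi : ∀ r, freq i (T r) = r.1) {g : ℝ × ℝ × ℝ → ℝ} {a b : ℝ}
    (hg : IntegrableOn g (slab i a b)) :
    IntegrableOn (fun r => g (T r)) (Ioo a b ×ˢ univ) ∧
      ∫ r in Ioo a b ×ˢ univ, g (T r) = ∫ q in slab i a b, g q := by
  have hpre : T ⁻¹' slab i a b = Ioo a b ×ˢ univ := by
    ext r
    simp [slab, hTi]
  rw [← hpre]
  exact integrable_and_integral_comp (hT.restrict_preimage (measurableSet_slab i a b)) hg

/-- The weak form of the flux identity: flux increments are integrals of the collision operator. -/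
lemma JM_sub_JM (hf : Measurable f) (hfE : ∀ ω > (0 : ℝ), ω ^ (7 / 6 : ℝ) * |f ω| ≤ M)
    {a b : ℝ} (ha : 0 < a) (hab : a < b) :
    JM f b - JM f a = ∫ ω in Ioo a b, √ω * -collisionOp f ω := by
  have hslab : ∀ i : Fin 4, IntegrableOn (fluxDensity f) (slab i a b) := fun i =>
    integrableOn_fluxDensity_of_kz hf hfE (integrableOn_fluxDensity_kz_slab i ha (ha.trans hab))
  have hcross : ∀ (i j : Fin 4) (ω : ℝ), 0 < ω → IntegrableOn (fluxDensity f) (crossing i j ω) :=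
    fun i j ω hω => integrableOn_fluxDensity_of_kz hf hfE (integrableOn_fluxDensity_kz_crossing i j hω)
  have hT₂ : MeasurePreserving (fun r : ℝ × ℝ × ℝ => (r.2.1, r.2.2, r.1)) :=
    measurePreserving_swap₂₃.comp measurePreserving_swap₁₂
  have hT₃ := measurePreserving_swap₃₄.comp hT₂
  have hT₀ := measurePreserving_swap_pairs.comp hT₃
  have hT₁ := measurePreserving_swap₁₂.comp (measurePreserving_swap₃₄.comp hT₀)
  obtain ⟨i2, e2⟩ := slab_comp hT₂ (i := 2) (fun r => rfl) (hslab 2)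
  obtain ⟨i3, e3⟩ := slab_comp hT₃ (i := 3) (fun r => by simp) (hslab 3)
  obtain ⟨i0, e0⟩ := slab_comp hT₀ (i := 0) (fun r => by simp) (hslab 0)
  obtain ⟨i1, e1⟩ := slab_comp hT₁ (i := 1) (fun r => by simp) (hslab 1)
  have hdens : ∀ r, collisionDensity f r = _ := fun r => collisionDensity_eq f r
  have hint : IntegrableOn (collisionDensity f) (Ioo a b ×ˢ univ) := by
    refine (((i2.add i3).sub i0).sub i1).congr (Eventually.of_forall fun r => ?_)
    simp [hdens]
  have hval : ∫ r in Ioo a b ×ˢ univ, collisionDensity f r =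
      (∫ q in slab 2 a b, fluxDensity f q) + (∫ q in slab 3 a b, fluxDensity f q) -
      (∫ q in slab 0 a b, fluxDensity f q) - ∫ q in slab 1 a b, fluxDensity f q := by
    rw [← e0, ← e1, ← e2, ← e3]
    refine Eq.trans ?_ ((integral_sub ((i2.add i3).sub i0) i1).trans (congrArg (· - _)
      ((integral_sub (i2.add i3) i0).trans (congrArg (· - _) (integral_add i2 i3)))))
    congr 1 with r
    simp [hdens]
  have hfub : ∫ r in Ioo a b ×ˢ univ, collisionDensity f r =
      ∫ ω in Ioo a b, √ω * collisionOp f ω := by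
    rw [Measure.volume_eq_prod, setIntegral_prod _ hint]
    simp only [setIntegral_univ, sqrt_mul_collisionOp]
  simp only [mul_neg]
  rw [integral_neg, ← hfub, hval, JM_eq_crossing, JM_eq_crossing]
  have c1 := crossing_increment hab hcross hslab ha 1 2
  have c2 := crossing_increment hab hcross hslab ha 0 3
  linear_combination c1 + c2

/-! ### Limits of the flux -/

open scoped Pointwise in
lemma setIntegral_crossing_eq_rescaled (f : ℝ → ℝ) (i j : Fin 4) {s : ℝ} (hs : 0 < s) :
    ∫ q in crossing i j s, fluxDensity f q =
      ∫ q in crossing i j 1, fluxDensity (fun σ => s ^ (7 / 6 : ℝ) * f (s * σ)) q := by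
  have hset : s • crossing i j 1 = crossing i j s := by
    ext q
    rw [mem_smul_set_iff_inv_smul_mem₀ hs.ne']
    simp only [crossing, mem_ofPred_eq, freq_smul, inv_mul_lt_iff₀ hs, lt_inv_mul_iff₀ hs, mul_one]
  have h := Measure.setIntegral_comp_smul_of_pos volume (fluxDensity f) (crossing i j 1) hs
  have hfin : Module.finrank ℝ (ℝ × ℝ × ℝ) = 3 := by simp
  rw [hset, hfin] at h
  simp only [fluxDensity_smul f hs, integral_const_mul, smul_eq_mul] at h
  exact (mul_left_cancel₀ (by positivity) h).symm

lemma tendsto_setIntegral_crossing (hf : Measurable f)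
    (hfE : ∀ ω > (0 : ℝ), ω ^ (7 / 6 : ℝ) * |f ω| ≤ M) {l : Filter ℝ} [l.IsCountablyGenerated]
    (hl : ∀ᶠ s in l, 0 < s) (hscale : ∀ x > (0 : ℝ), Tendsto (fun s => s * x) l l) {c : ℝ}
    (hc : Tendsto (fun ω => ω ^ (7 / 6 : ℝ) * f ω) l (nhds c)) (i j : Fin 4) :
    Tendsto (fun s => ∫ q in crossing i j s, fluxDensity f q) l
      (nhds (c ^ 3 * ∫ q in crossing i j 1, fluxDensity kz q)) := by
  have hpt : ∀ x > 0, Tendsto (fun s => s ^ (7 / 6 : ℝ) * f (s * x)) l (nhds (c * kz x)) := by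
    intro x hx
    refine ((hc.comp (hscale x hx)).mul_const (kz x)).congr' ?_
    filter_upwards [hl] with s hs
    have hinv : x ^ (7 / 6 : ℝ) * kz x = 1 := by
      rw [kz, ← Real.rpow_add hx]
      norm_num
    simp only [Function.comp_apply, Real.mul_rpow hs.le hx.le]
    linear_combination (s ^ (7 / 6 : ℝ) * f (s * x)) * hinv
  have hbound : ∀ s > (0 : ℝ), ∀ ω > (0 : ℝ),
      ω ^ (7 / 6 : ℝ) * |s ^ (7 / 6 : ℝ) * f (s * ω)| ≤ M := by
    intro s hs ω hω
    refine le_trans (le_of_eq ?_) (hfE (s * ω) (mul_pos hs hω))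
    rw [abs_mul, abs_of_pos (Real.rpow_pos_of_pos hs _), Real.mul_rpow hs.le hω.le]
    ring
  rw [← integral_const_mul]
  refine Tendsto.congr' (hl.mono fun s hs => (setIntegral_crossing_eq_rescaled f i j hs).symm) ?_
  refine tendsto_integral_filter_of_dominated_convergence (fun q => M ^ 3 * fluxDensity kz q)
    (Eventually.of_forall fun s => (measurable_fluxDensity (by fun_prop)).aestronglyMeasurable)
    (hl.mono fun s hs => Eventually.of_forall (abs_fluxDensity_le (hbound s hs)))
    ((integrableOn_fluxDensity_kz_crossing i j one_pos).const_mul _)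
    (Eventually.of_forall fun q => ?_)
  by_cases h0 : minSqrt q.1 q.2.1 q.2.2 (q.1 + q.2.1 - q.2.2) = 0
  · simp only [fluxDensity, h0, zero_mul, mul_zero]
    exact tendsto_const_nhds
  · have hp := freq_pos_of_minSqrt_ne_zero h0
    have := (((hpt _ (hp 0)).const_mul (minSqrt q.1 q.2.1 q.2.2 (q.1 + q.2.1 - q.2.2))).mul
      (hpt _ (hp 1))).mul (hpt _ (hp 2))
    refine (this.congr fun s => rfl).trans_eq ?_
    simp only [fluxDensity, freq_zero, freq_one, freq_two]
    congr 1
    ring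

lemma tendsto_JM (hf : Measurable f)
    (hfE : ∀ ω > (0 : ℝ), ω ^ (7 / 6 : ℝ) * |f ω| ≤ M) {l : Filter ℝ} [l.IsCountablyGenerated]
    (hl : ∀ᶠ s in l, 0 < s) (hscale : ∀ x > (0 : ℝ), Tendsto (fun s => s * x) l l) {c : ℝ}
    (hc : Tendsto (fun ω => ω ^ (7 / 6 : ℝ) * f ω) l (nhds c)) :
    Tendsto (JM f) l (nhds (c ^ 3 * JM kz 1)) := by
  have h := tendsto_setIntegral_crossing hf hfE hl hscale hc
  have := (((h 1 2).add (h 0 3)).sub (h 2 1)).sub (h 3 0)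
  rw [JM_eq_crossing, mul_sub, mul_sub, mul_add]
  exact this.congr fun s => (JM_eq_crossing f s).symm

end Spectrum

/-- From pointwise equation to fluxes: if f ∈ E_{7/6,7/6} solves −𝒞(f) = φ with
asymptotics c₀ ω^{-7/6} at 0 and c_∞ ω^{-7/6} at ∞, then, with
j_M* = −J_M(ω^{-7/6})(1) > 0, the mass balance c₀³ = c_∞³ + M(φ)/j_M* holds and
J_M(f)(ω) = −c₀³ j_M* + ∫₀^ω √σ φ(σ) dσ. -/
theorem stmt_19 (f φ : ℝ → ℝ) (hf : Measurable f) (hφ : Measurable φ)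
    (M c₀ cinf : ℝ)
    (hfE : ∀ ω > (0:ℝ), ω ^ (7/6 : ℝ) * |f ω| ≤ M)
    (hφint : IntegrableOn (fun ω : ℝ => Real.sqrt ω * φ ω) (Ioi 0))
    (heq : ∀ ω > (0:ℝ), -(collisionOp f ω) = φ ω)
    (h0 : Tendsto (fun ω => ω ^ (7/6 : ℝ) * f ω) (nhdsWithin 0 (Ioi 0)) (nhds c₀))
    (hinf : Tendsto (fun ω => ω ^ (7/6 : ℝ) * f ω) atTop (nhds cinf)) :
    0 < -(JM (fun σ => σ ^ (-(7:ℝ)/6)) 1) ∧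
    c₀ ^ 3 = cinf ^ 3 +
      (∫ ω in Ioi (0:ℝ), Real.sqrt ω * φ ω) / (-(JM (fun σ => σ ^ (-(7:ℝ)/6)) 1)) ∧
    ∀ ω > (0:ℝ), JM f ω =
      -c₀ ^ 3 * (-(JM (fun σ => σ ^ (-(7:ℝ)/6)) 1)) +
        ∫ σ in Ioo (0:ℝ) ω, Real.sqrt σ * φ σ := by
  change 0 < -(JM kz 1) ∧ c₀ ^ 3 = cinf ^ 3 +
      (∫ ω in Ioi (0:ℝ), Real.sqrt ω * φ ω) / (-(JM kz 1)) ∧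
    ∀ ω > (0:ℝ), JM f ω = -c₀ ^ 3 * (-(JM kz 1)) + ∫ σ in Ioo (0:ℝ) ω, Real.sqrt σ * φ σ
  have hneg : JM kz 1 < 0 := JM_kz_neg one_pos
  have hincr : ∀ a b : ℝ, 0 < a → a < b → JM f b - JM f a = ∫ ω in Ioo a b, √ω * φ ω := by
    intro a b ha hab
    rw [JM_sub_JM hf hfE ha hab]
    refine setIntegral_congr_fun measurableSet_Ioo fun ω hω => ?_
    simp only [heq ω (ha.trans hω.1)]
  have hlim0 : Tendsto (JM f) (nhdsWithin 0 (Ioi 0)) (nhds (c₀ ^ 3 * JM kz 1)) := by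
    refine tendsto_JM hf hfE self_mem_nhdsWithin (fun x hx => ?_) h0
    refine tendsto_nhdsWithin_iff.2 ⟨?_, ?_⟩
    · have : Tendsto (fun s : ℝ => s * x) (nhds 0) (nhds (0 * x)) := tendsto_id.mul_const x
      rw [zero_mul] at this
      exact this.mono_left nhdsWithin_le_nhds
    · exact eventually_mem_nhdsWithin.mono fun s hs => mul_pos hs hx
  have hliminf : Tendsto (JM f) atTop (nhds (cinf ^ 3 * JM kz 1)) :=
    tendsto_JM hf hfE (eventually_gt_atTop 0) (fun x hx => tendsto_id.atTop_mul_const hx) hinf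
  have hflux : ∀ ω > (0:ℝ), JM f ω = c₀ ^ 3 * JM kz 1 + ∫ σ in Ioo (0:ℝ) ω, √σ * φ σ := by
    intro ω hω
    have hint : Tendsto (fun a => ∫ σ in Ioo a ω, √σ * φ σ) (nhdsWithin 0 (Ioi 0))
        (nhds (∫ σ in Ioo (0:ℝ) ω, √σ * φ σ)) := by
      have := (aecover_Ioo_of_Ioo (μ := volume) (l := nhdsWithin (0 : ℝ) (Ioi 0)) (a := id)
        (b := fun _ => ω) (A := 0) (B := ω) (tendsto_id.mono_left nhdsWithin_le_nhds)
        tendsto_const_nhds).integral_tendsto_of_countably_generated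
        (hφint.mono_set Ioo_subset_Ioi_self)
      refine this.congr' ?_
      filter_upwards [self_mem_nhdsWithin] with a ha
      rw [Measure.restrict_restrict measurableSet_Ioo,
        inter_eq_left.2 (Ioo_subset_Ioo_left (le_of_lt ha))]
      rfl
    have hdiff : Tendsto (fun a => JM f ω - JM f a) (nhdsWithin 0 (Ioi 0))
        (nhds (∫ σ in Ioo (0:ℝ) ω, √σ * φ σ)) := by
      refine hint.congr' ?_
      filter_upwards [Ioo_mem_nhdsGT hω] with a ha
      exact (hincr a ω ha.1 ha.2).symm
    linarith [tendsto_nhds_unique hdiff (tendsto_const_nhds.sub hlim0)]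
  have hbalance : cinf ^ 3 * JM kz 1 = c₀ ^ 3 * JM kz 1 + ∫ σ in Ioi (0:ℝ), √σ * φ σ := by
    have hint : Tendsto (fun ω => ∫ σ in Ioo (0:ℝ) ω, √σ * φ σ) atTop
        (nhds (∫ σ in Ioi (0:ℝ), √σ * φ σ)) := by
      have := (aecover_Iio (μ := volume.restrict (Ioi (0:ℝ))) (l := atTop) (b := id)
        tendsto_id).integral_tendsto_of_countably_generated hφint
      refine this.congr fun ω => ?_
      rw [Measure.restrict_restrict measurableSet_Iio, Iio_inter_Ioi]
      rfl
    refine tendsto_nhds_unique hliminf ((hint.const_add _).congr' ?_)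
    filter_upwards [eventually_gt_atTop 0] with ω hω
    exact (hflux ω hω).symm
  refine ⟨neg_pos.2 hneg, ?_, fun ω hω => ?_⟩
  · have := hneg.ne
    field_simp
    linarith
  · rw [hflux ω hω]
    ring
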